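/- Let L ≥ 2 and α : ZMod L → ℝ with the ω_i pairwise distinct, and let m⁺ be a threshold configuration (minimizer of max_i z(m)_i). Then ZFA(m⁺) = m⁺ + 1 (every site topples exactly once in the run). Conversely, if m : ZMod L → ℤ satisfies ZFA(m) = m + 1, then m = m⁺ + c·1 for some integer c, i.e. this property characterizes the family of threshold configurations. -/

import Mathlib

/-- The periodic discrete Laplacian on integer sequences indexed by `ZMod L`. -/
def lapZ {L : ℕ} (v : ZMod L → ℤ) (i : ZMod L) : ℤ :=
  v (i - 1) - 2 * v i + v (i + 1)

/-- The periodic discrete Laplacian on real sequences indexed by `ZMod L`. -/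
def lapR {L : ℕ} (v : ZMod L → ℝ) (i : ZMod L) : ℝ :=
  v (i - 1) - 2 * v i + v (i + 1)

/-- Rescaled well coordinates of the toy CDW model: `z(m)_i = (Δm)_i + (Δα)_i`. -/
noncomputable def zco {L : ℕ} (α : ZMod L → ℝ) (m : ZMod L → ℤ) (i : ZMod L) : ℝ :=
  (lapZ m i : ℝ) + lapR α i

/-- `max_i z(m)_i` over the (finite, nonempty) set of sites. -/
noncomputable def zmax {L : ℕ} [NeZero L] (α : ZMod L → ℝ) (m : ZMod L → ℤ) : ℝ :=
  Finset.univ.sup' ⟨0, Finset.mem_univ 0⟩ (zco α m)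

/-- `ω_i = (Δα)_i − ⌊(Δα)_i⌉`, the fractional part of the Laplacian of the disorder. -/
noncomputable def omegaF {L : ℕ} (α : ZMod L → ℝ) (i : ZMod L) : ℝ :=
  lapR α i - round (lapR α i)

/-- Toppling site `j`: increment the well number at `j` by one. -/
def topple {L : ℕ} (m : ZMod L → ℤ) (j : ZMod L) : ZMod L → ℤ :=
  fun i => m i + if i = j then 1 else 0

/-- A run of the zero-force avalanche algorithm (ZFA) starting from `m0`, with record
`M = max_i z(m0)_i`: the sequence `m0 = ms 0, ms 1, …, ms N` in which `ms (k+1)` is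
obtained from `ms k` by toppling the site `js k`; `js 0` attains `max_i z(ms 0)_i`;
for `1 ≤ k < N` the site `js k` attains `max_i z(ms k)_i` and satisfies
`z(ms k)_{js k} > M`; and `N` is the first index `≥ 1` with `max_i z(ms N)_i ≤ M`. -/
def IsZFARun {L : ℕ} [NeZero L] (α : ZMod L → ℝ) (m0 : ZMod L → ℤ)
    (N : ℕ) (ms : ℕ → ZMod L → ℤ) (js : ℕ → ZMod L) : Prop :=
  ms 0 = m0 ∧ 1 ≤ N ∧
  (∀ k < N, ms (k + 1) = topple (ms k) (js k)) ∧
  (∀ k < N, ∀ i : ZMod L, zco α (ms k) i ≤ zco α (ms k) (js k)) ∧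
  (∀ k, 1 ≤ k → k < N → zmax α m0 < zco α (ms k) (js k)) ∧
  zmax α (ms N) ≤ zmax α m0 ∧
  (∀ k, 1 ≤ k → k < N → zmax α m0 < zmax α (ms k))

section Configurations

variable {L : ℕ} {α : ZMod L → ℝ}

theorem eq_of_zco_eq (hdist : Function.Injective (omegaF α)) {m m' : ZMod L → ℤ}
    {i j : ZMod L} (h : zco α m i = zco α m' j) : i = j := by
  apply hdist
  have hl : lapR α i = lapR α j + ((lapZ m' j - lapZ m i : ℤ) : ℝ) := by
    unfold zco at h
    push_cast
    linarith
  unfold omegaF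
  rw [hl, round_add_intCast]
  push_cast
  ring

theorem lapZ_add_const (m : ZMod L → ℤ) (c : ℤ) (i : ZMod L) :
    lapZ (fun x => m x + c) i = lapZ m i := by
  unfold lapZ
  ring

theorem zco_add_const (m : ZMod L → ℤ) (c : ℤ) (i : ZMod L) :
    zco α (fun x => m x + c) i = zco α m i := by
  unfold zco
  rw [lapZ_add_const]

theorem zco_le_zco_of_lapZ_le {m m' : ZMod L → ℤ} {i : ZMod L} (h : lapZ m i ≤ lapZ m' i) :
    zco α m i ≤ zco α m' i := by
  unfold zco
  have : (lapZ m i : ℝ) ≤ lapZ m' i := by exact_mod_cast h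
  linarith

/-- The coordinate at a site where two ordered configurations touch is monotone. -/
theorem zco_le_zco_of_le_of_eq {m m' : ZMod L → ℤ} (hle : ∀ i, m i ≤ m' i) {i : ZMod L}
    (h : m i = m' i) : zco α m i ≤ zco α m' i := by
  apply zco_le_zco_of_lapZ_le
  have h1 := hle (i - 1)
  have h2 := hle (i + 1)
  unfold lapZ
  omega

theorem zco_min_le {m m' : ZMod L → ℤ} {M : ℝ} (h : ∀ i, zco α m i ≤ M)
    (h' : ∀ i, zco α m' i ≤ M) (i : ZMod L) : zco α (fun x => min (m x) (m' x)) i ≤ M := by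
  rcases le_total (m i) (m' i) with hi | hi
  · exact (zco_le_zco_of_le_of_eq (fun x => min_le_left _ _) (min_eq_left hi)).trans (h i)
  · exact (zco_le_zco_of_le_of_eq (fun x => min_le_right _ _) (min_eq_right hi)).trans (h' i)

theorem zco_le_zmax [NeZero L] (m : ZMod L → ℤ) (i : ZMod L) : zco α m i ≤ zmax α m :=
  Finset.le_sup' (zco α m) (Finset.mem_univ i)

theorem exists_zco_eq_zmax [NeZero L] (α : ZMod L → ℝ) (m : ZMod L → ℤ) :
    ∃ i, zco α m i = zmax α m := by
  obtain ⟨i, -, hi⟩ := Finset.exists_mem_eq_sup' (⟨0, Finset.mem_univ 0⟩ :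
    (Finset.univ : Finset (ZMod L)).Nonempty) (zco α m)
  exact ⟨i, hi.symm⟩

open Classical in
/-- The configuration obtained by toppling every site of `S` once. -/
noncomputable def toppleSet (m : ZMod L → ℤ) (S : Set (ZMod L)) : ZMod L → ℤ :=
  fun i => m i + if i ∈ S then 1 else 0

/-- The sites of `S` both of whose neighbours lie in `S`. -/
def siteInterior (S : Set (ZMod L)) : Set (ZMod L) :=
  {i | i ∈ S ∧ i - 1 ∈ S ∧ i + 1 ∈ S}

theorem zco_toppleSet_siteInterior_le {q : ZMod L → ℤ} {S : Set (ZMod L)} {M : ℝ}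
    (hq : ∀ i, zco α q i ≤ M) (hS : ∀ i, zco α (toppleSet q S) i ≤ M) (i : ZMod L) :
    zco α (toppleSet (toppleSet q S) (siteInterior S)) i ≤ M := by
  by_cases hi : i ∈ S
  · by_cases hi' : i ∈ siteInterior S
    · refine (zco_le_zco_of_lapZ_le ?_).trans (hS i)
      simp only [lapZ, toppleSet.eq_def (toppleSet q S), if_pos hi']
      split_ifs <;> omega
    · refine (zco_le_zco_of_lapZ_le ?_).trans (hq i)
      have hn : ¬ (i - 1 ∈ S ∧ i + 1 ∈ S) := fun h => hi' ⟨hi, h⟩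
      have h1 : i - 1 ∈ siteInterior S → i - 1 ∈ S := fun h => h.1
      have h2 : i + 1 ∈ siteInterior S → i + 1 ∈ S := fun h => h.1
      simp only [lapZ, toppleSet, if_pos hi, if_neg hi']
      split_ifs <;> first | omega | tauto
  · refine (zco_le_zco_of_lapZ_le ?_).trans (hS i)
    have h0 : i ∉ siteInterior S := fun h => hi h.1
    have h1 : i - 1 ∉ siteInterior S := fun h => hi (by simpa using h.2.2)
    have h2 : i + 1 ∉ siteInterior S := fun h => hi (by simpa using h.2.1)
    simp [lapZ, toppleSet.eq_def (toppleSet q S), h0, h1, h2]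

theorem zco_toppleSet_le_sub_one {q : ZMod L → ℤ} {S : Set (ZMod L)} {i : ZMod L}
    (hi : i ∈ S) (hi' : i ∉ siteInterior S) : zco α (toppleSet q S) i ≤ zco α q i - 1 := by
  have hn : ¬ (i - 1 ∈ S ∧ i + 1 ∈ S) := fun h => hi' ⟨hi, h⟩
  have h : lapZ (toppleSet q S) i ≤ lapZ q i - 1 := by
    simp only [lapZ, toppleSet, if_pos hi]
    split_ifs <;> first | omega | tauto
  have h' : (lapZ (toppleSet q S) i : ℝ) ≤ lapZ q i - 1 := by exact_mod_cast h
  unfold zco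
  linarith

/-- If toppling all of `S` keeps a configuration below the minimal threshold `M`, and `S`
contains the site `j` at which the value `M` is attained, then `S` contains every site
`j - k`: otherwise toppling successive interiors of `S` would beat the threshold. -/
theorem sub_natCast_mem_of_zco_toppleSet_le [NeZero L] (hdist : Function.Injective (omegaF α))
    {M : ℝ} (hM : ∀ m, M ≤ zmax α m) {p : ZMod L → ℤ} {j : ZMod L} (hj : zco α p j = M)
    (k : ℕ) : ∀ (q : ZMod L → ℤ) (S : Set (ZMod L)), (∀ i, zco α q i ≤ M) →
      (∀ i, zco α (toppleSet q S) i ≤ M) → j ∈ S → j - (k : ZMod L) ∈ S := by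
  induction k with
  | zero => intro q S _ _ hjS; simpa using hjS
  | succ k ih =>
    intro q S hq hS hjS
    by_cases hj' : j ∈ siteInterior S
    · have h := ih (toppleSet q S) (siteInterior S) hS
        (zco_toppleSet_siteInterior_le hq hS) hj'
      have h1 := h.2.1
      rwa [sub_sub, ← Nat.cast_succ] at h1
    · exfalso
      obtain ⟨i, hi⟩ := exists_zco_eq_zmax α (toppleSet q S)
      have hiM : zco α (toppleSet q S) i = zco α p j :=
        le_antisymm ((hS i).trans hj.ge) (by rw [hi, hj]; exact hM _)
      obtain rfl := eq_of_zco_eq hdist hiM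
      have h1 := zco_toppleSet_le_sub_one (α := α) (q := q) hjS hj'
      have h2 := hq i
      linarith

theorem mem_of_zco_toppleSet_le [NeZero L] (hdist : Function.Injective (omegaF α))
    {M : ℝ} (hM : ∀ m, M ≤ zmax α m) {p : ZMod L → ℤ} {j : ZMod L} (hj : zco α p j = M)
    {q : ZMod L → ℤ} {S : Set (ZMod L)} (hq : ∀ i, zco α q i ≤ M)
    (hS : ∀ i, zco α (toppleSet q S) i ≤ M) (hjS : j ∈ S) (i : ZMod L) : i ∈ S := by
  have h := sub_natCast_mem_of_zco_toppleSet_le hdist hM hj (j - i).val q S hq hS hjS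
  simpa using h

end Configurations

section Runs

variable {L : ℕ} {α : ZMod L → ℝ} {N : ℕ} {ms : ℕ → ZMod L → ℤ} {js : ℕ → ZMod L}

/-- A sequence of topplings of sites above level `M` stays below every configuration `X`
that respects the level `M` and dominates the configuration after the first toppling. -/
theorem topplings_le {M : ℝ} {X : ZMod L → ℤ} (hX : ∀ i, zco α X i ≤ M)
    (hstep : ∀ k < N, ms (k + 1) = topple (ms k) (js k))
    (hgt : ∀ k, 1 ≤ k → k < N → M < zco α (ms k) (js k))
    (h0 : ∀ i, ms 0 i ≤ X i) (hj0 : ms 0 (js 0) < X (js 0)) :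
    ∀ k ≤ N, ∀ i, ms k i ≤ X i := by
  intro k
  induction k with
  | zero => exact fun _ => h0
  | succ k ih =>
    intro hk i
    have ihk := ih (by omega)
    have hlt : ms k (js k) < X (js k) := by
      rcases Nat.eq_zero_or_pos k with rfl | hpos
      · exact hj0
      · refine lt_of_le_of_ne (ihk _) fun heq => ?_
        exact absurd ((zco_le_zco_of_le_of_eq ihk heq).trans (hX _))
          (not_le.mpr (hgt k hpos (by omega)))
    rw [hstep k (by omega)]
    unfold topple
    split_ifs with h
    · subst h; omega
    · simpa using ihk i

theorem monotone_topplings (hstep : ∀ k < N, ms (k + 1) = topple (ms k) (js k))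
    {k l : ℕ} (hkl : k ≤ l) (hl : l ≤ N) (i : ZMod L) : ms k i ≤ ms l i := by
  induction l, hkl using Nat.le_induction with
  | base => exact le_rfl
  | succ l _ ih =>
    refine (ih (by omega)).trans ?_
    rw [hstep l (by omega)]
    unfold topple
    split_ifs <;> omega

theorem sum_topplings [NeZero L] (hstep : ∀ k < N, ms (k + 1) = topple (ms k) (js k)) :
    ∀ k ≤ N, ∑ i, ms k i = ∑ i, ms 0 i + k := by
  intro k
  induction k with
  | zero => simp
  | succ k ih =>
    intro hk
    rw [hstep k (by omega)]
    simp [topple, Finset.sum_add_distrib, ih (by omega), add_assoc]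

variable [NeZero L] {m : ZMod L → ℤ}

theorem IsZFARun.zco_eq_zmax (h : IsZFARun α m N ms js) : zco α m (js 0) = zmax α m := by
  obtain ⟨rfl, hN, -, hmax, -⟩ := h
  obtain ⟨i, hi⟩ := exists_zco_eq_zmax α (ms 0)
  exact le_antisymm (zco_le_zmax _ _) (hi ▸ hmax 0 hN i)

/-- An avalanche stays below `m + 1`, so it stops after finitely many topplings. -/
theorem exists_isZFARun (α : ZMod L → ℝ) (m : ZMod L → ℤ) :
    ∃ N ms js, IsZFARun α m N ms js := by
  choose a ha using exists_zco_eq_zmax α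
  let ms : ℕ → ZMod L → ℤ := fun k => (fun x => topple x (a x))^[k] m
  have hstep : ∀ k, ms (k + 1) = topple (ms k) (a (ms k)) := fun k =>
    Function.iterate_succ_apply' _ _ _
  have hex : ∃ N, 1 ≤ N ∧ zmax α (ms N) ≤ zmax α m := by
    by_contra! hno
    have hle := topplings_le (N := L + 1) (ms := ms) (js := fun k => a (ms k))
      (X := fun i => m i + 1) (M := zmax α m)
      (fun i => (zco_add_const m 1 i).le.trans (zco_le_zmax m i)) (fun k _ => hstep k)
      (fun k hk _ => (hno k hk).trans_eq (ha _).symm)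
      (fun i => by simp [ms]) (by simp [ms]) (L + 1) le_rfl
    have hsum := sum_topplings (N := L + 1) (fun k _ => hstep k) (L + 1) le_rfl
    have hs : ∑ i, ms (L + 1) i ≤ ∑ i, (m i + 1) := Finset.sum_le_sum fun i _ => hle i
    rw [hsum] at hs
    simp [ms, Finset.sum_add_distrib, ZMod.card] at hs
  classical
  obtain ⟨h1, h2⟩ := Nat.find_spec hex
  have hmin : ∀ k, 1 ≤ k → k < Nat.find hex → zmax α m < zmax α (ms k) := fun k hk hlt =>
    not_le.mp fun h => Nat.find_min hex hlt ⟨hk, h⟩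
  exact ⟨Nat.find hex, ms, fun k => a (ms k), rfl, h1, fun k _ => hstep k,
    fun k _ i => (zco_le_zmax _ i).trans_eq (ha _).symm,
    fun k hk hlt => (hmin k hk hlt).trans_eq (ha _).symm, h2, hmin⟩

theorem IsZFARun.eq_add_one (hdist : Function.Injective (omegaF α))
    (hthr : ∀ m', zmax α m ≤ zmax α m') (h : IsZFARun α m N ms js) (i : ZMod L) :
    ms N i = m i + 1 := by
  have hj := h.zco_eq_zmax
  obtain ⟨rfl, hN, hstep, -, hgt, hend, -⟩ := h
  have hle := topplings_le (X := fun i => ms 0 i + 1)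
    (fun i => (zco_add_const (ms 0) 1 i).le.trans (zco_le_zmax _ i)) hstep hgt
    (fun i => by simp) (by simp) N le_rfl
  have hge := monotone_topplings hstep (Nat.zero_le N) le_rfl
  have heq : toppleSet (ms 0) {x | ms N x = ms 0 x + 1} = ms N := by
    funext x
    have h1 := hle x
    have h2 := hge x
    simp only [toppleSet, Set.mem_ofPred_eq]
    split_ifs <;> omega
  refine mem_of_zco_toppleSet_le (S := {x | ms N x = ms 0 x + 1}) hdist hthr hj
    (zco_le_zmax (ms 0)) (fun x => ?_) ?_ i
  · rw [heq]
    exact (zco_le_zmax _ x).trans hend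
  · refine le_antisymm (hle _) ?_
    have h1 := monotone_topplings hstep hN le_rfl (js 0)
    rw [hstep 0 hN] at h1
    simpa [topple] using h1

/-- Threshold configurations that are ordered and touch at the maximal site coincide. -/
theorem eq_of_le_of_eq_of_zco_le (hdist : Function.Injective (omegaF α)) {M : ℝ}
    (hM : ∀ m', M ≤ zmax α m') {X : ZMod L → ℤ} (hm : ∀ i, zco α m i ≤ M)
    (hX : ∀ i, zco α X i ≤ M) (hle : ∀ i, m i ≤ X i) {j : ZMod L} (hj : m j = X j)
    (hjM : zco α m j = M) (i : ZMod L) : m i = X i := by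
  have heq : toppleSet (fun x => min (X x) (m x + 1)) {x | m x = X x} = fun x => m x + 1 := by
    funext x
    have h1 := hle x
    simp only [toppleSet, Set.mem_ofPred_eq]
    split_ifs <;> omega
  have hm1 : ∀ x, zco α (fun x => m x + 1) x ≤ M := fun x => (zco_add_const m 1 x).le.trans (hm x)
  exact mem_of_zco_toppleSet_le (S := {x | m x = X x}) hdist hM hjM (zco_min_le hX hm1)
    (by rw [heq]; exact hm1) hj i

theorem IsZFARun.exists_eq_add_const (hdist : Function.Injective (omegaF α))
    {mplus : ZMod L → ℤ} (hthr : ∀ m', zmax α mplus ≤ zmax α m')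
    (h : IsZFARun α m N ms js) (hend : ∀ i, ms N i = m i + 1) :
    ∃ c : ℤ, ∀ i, m i = mplus i + c := by
  have hj := h.zco_eq_zmax
  obtain ⟨rfl, hN, hstep, -, hgt, -⟩ := h
  obtain ⟨j, -, hjmax⟩ := Finset.exists_max_image Finset.univ (fun i => ms 0 i - mplus i)
    ⟨0, Finset.mem_univ 0⟩
  refine ⟨ms 0 j - mplus j, ?_⟩
  set X : ZMod L → ℤ := fun i => mplus i + (ms 0 j - mplus j) with hXdef
  have hX : ∀ i, zco α X i ≤ zmax α mplus := fun i =>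
    (zco_add_const mplus _ i).le.trans (zco_le_zmax _ i)
  have hle : ∀ i, ms 0 i ≤ X i := fun i => by
    have := hjmax i (Finset.mem_univ i)
    simp only [hXdef]
    omega
  have htouch : ms 0 (js 0) = X (js 0) := by
    refine le_antisymm (hle _) (not_lt.mp fun hlt => ?_)
    have h1 := topplings_le (fun i => (hX i).trans (hthr _)) hstep hgt hle hlt N le_rfl j
    rw [hend j] at h1
    simp only [hXdef] at h1
    omega
  have hM : zmax α (ms 0) = zmax α mplus :=
    le_antisymm (hj ▸ (zco_le_zco_of_le_of_eq hle htouch).trans (hX _)) (hthr _)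
  exact eq_of_le_of_eq_of_zco_le hdist hthr (fun i => hM ▸ zco_le_zmax _ i) hX hle htouch
    (hj.trans hM)

end Runs

/-- **The ZFA characterizes threshold configurations (Proposition 3.6 (iii)).**
If the `ω_i` are pairwise distinct and `m⁺` is a threshold configuration (a minimizer of
`max_i z(m)_i`), then a ZFA run from `m⁺` exists, every ZFA run from `m⁺` ends at
`m⁺ + 1` (each site topples exactly once); conversely any configuration `m` whose ZFA
result is `m + 1` is of the form `m⁺ + c·1` for some integer `c`. -/
theorem zfa_threshold_characterization (L : ℕ) [NeZero L] (hL : 2 ≤ L) (α : ZMod L → ℝ)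
    (hdist : Function.Injective (omegaF α))
    (mplus : ZMod L → ℤ)
    (hthr : ∀ m : ZMod L → ℤ, zmax α mplus ≤ zmax α m) :
    (∃ (N : ℕ) (ms : ℕ → ZMod L → ℤ) (js : ℕ → ZMod L), IsZFARun α mplus N ms js) ∧
    (∀ (N : ℕ) (ms : ℕ → ZMod L → ℤ) (js : ℕ → ZMod L),
      IsZFARun α mplus N ms js → ∀ i : ZMod L, ms N i = mplus i + 1) ∧
    (∀ (m : ZMod L → ℤ) (N : ℕ) (ms : ℕ → ZMod L → ℤ) (js : ℕ → ZMod L),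
      IsZFARun α m N ms js → (∀ i : ZMod L, ms N i = m i + 1) →
      ∃ c : ℤ, ∀ i : ZMod L, m i = mplus i + c) := by
  exact ⟨exists_isZFARun α mplus, fun _ _ _ h => h.eq_add_one hdist hthr,
    fun _ _ _ _ h hend => h.exists_eq_add_const hdist hthr hend⟩
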